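/- For each integer k ≥ 0, the set of P-positions of the game T_k is {(0,0)} ∪ {(A_n + 1, B_n + 1) : n ≥ 0} ∪ {(B_n + 1, A_n + 1) : n ≥ 0}; in particular this set is independent of k. -/

import Mathlib

noncomputable def phi : ℝ := (1 + Real.sqrt 5) / 2
noncomputable def wA (n : ℕ) : ℕ := ⌊phi * n⌋₊
noncomputable def wB (n : ℕ) : ℕ := ⌊phi ^ 2 * n⌋₊

/-- A legal move in the game `T_k` from `p` to `q`: a Nim move, or a diagonal move
removing `s` tokens from both piles, with `min p.1 p.2 - s > 0` and the integer ratios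
of larger over smaller entry before and after the move differing by at most `k`. -/
def TkMove (k : ℕ) (p q : ℕ × ℕ) : Prop :=
  (∃ t, 1 ≤ t ∧ t ≤ p.1 ∧ q = (p.1 - t, p.2)) ∨
  (∃ t, 1 ≤ t ∧ t ≤ p.2 ∧ q = (p.1, p.2 - t)) ∨
  (∃ s, 1 ≤ s ∧ s ≤ min p.1 p.2 ∧ 0 < min p.1 p.2 - s ∧
    |((max (p.1 - s) (p.2 - s) / min (p.1 - s) (p.2 - s) : ℕ) : ℤ) -
      ((max p.1 p.2 / min p.1 p.2 : ℕ) : ℤ)| ≤ (k : ℤ) ∧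
    q = (p.1 - s, p.2 - s))

/-- `S` is the set of P-positions of the game with move relation `move`. -/
def IsPPositions (move : ℕ × ℕ → ℕ × ℕ → Prop) (S : Set (ℕ × ℕ)) : Prop :=
  (∀ p ∈ S, ∀ q ∈ S, ¬ move p q) ∧ (∀ p ∉ S, ∃ q ∈ S, move p q)

/-- `G` is the Sprague–Grundy function of the game with move relation `move`:
at every position, `G` takes the mex of the values of the options. -/
def IsGrundy (move : ℕ × ℕ → ℕ × ℕ → Prop) (G : ℕ × ℕ → ℕ) : Prop :=
  ∀ p, (∀ q, move p q → G q ≠ G p) ∧ (∀ v, v < G p → ∃ q, move p q ∧ G q = v)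

theorem phi_eq_goldenRatio : phi = Real.goldenRatio := rfl

theorem wA_zero : wA 0 = 0 := by simp [wA]

theorem wB_eq_wA_add (n : ℕ) : wB n = wA n + n := by
  have h : phi ^ 2 * (n : ℝ) = phi * n + n := by
    rw [phi_eq_goldenRatio, Real.goldenRatio_sq]; ring
  have h0 : 0 ≤ phi * (n : ℝ) :=
    mul_nonneg (phi_eq_goldenRatio ▸ Real.goldenRatio_pos.le) n.cast_nonneg
  rw [wB, wA, h, Nat.floor_add_natCast h0]

theorem wA_strictMono : StrictMono wA := by
  refine strictMono_nat_of_lt_succ fun n => ?_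
  have h1 : 1 < phi := phi_eq_goldenRatio ▸ Real.one_lt_goldenRatio
  have h0 : 0 ≤ phi * (n : ℝ) := mul_nonneg (by linarith) n.cast_nonneg
  rw [wA, wA, Nat.lt_iff_add_one_le, ← Nat.floor_add_one h0]
  apply Nat.floor_le_floor
  push_cast
  linarith

theorem holderConjugate_phi_phi_sq : phi.HolderConjugate (phi ^ 2) := by
  have h1 : 1 < phi := phi_eq_goldenRatio ▸ Real.one_lt_goldenRatio
  have h2 : phi ^ 2 = phi + 1 := phi_eq_goldenRatio ▸ Real.goldenRatio_sq
  refine Real.holderConjugate_iff.2 ⟨h1, ?_⟩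
  have h0 : phi ≠ 0 := by linarith
  field_simp
  linarith

theorem beattySeq_natCast {r : ℝ} (hr : 0 ≤ r) (n : ℕ) :
    beattySeq r n = (⌊r * n⌋₊ : ℤ) := by
  rw [beattySeq, Int.cast_natCast, mul_comm, Int.natCast_floor_eq_floor]
  exact mul_nonneg hr n.cast_nonneg

theorem mem_beattySeq_pos_iff {r : ℝ} (hr : 0 ≤ r) (x : ℕ) :
    (x : ℤ) ∈ {beattySeq r k | k > 0} ↔ ∃ n : ℕ, 0 < n ∧ ⌊r * n⌋₊ = x := by
  constructor
  · rintro ⟨k, hk, h⟩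
    lift k to ℕ using hk.le
    rw [beattySeq_natCast hr] at h
    exact ⟨k, by exact_mod_cast hk, by exact_mod_cast h⟩
  · rintro ⟨n, hn, rfl⟩
    exact ⟨n, by exact_mod_cast hn, beattySeq_natCast hr n⟩

theorem pos_iff_xor_wA_wB (x : ℕ) :
    0 < x ↔ Xor (∃ n, 0 < n ∧ wA n = x) (∃ n, 0 < n ∧ wB n = x) := by
  have hp : 0 ≤ phi := phi_eq_goldenRatio ▸ Real.goldenRatio_pos.le
  have h := Irrational.beattySeq_symmDiff_beattySeq_pos holderConjugate_phi_phi_sq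
    (phi_eq_goldenRatio ▸ Real.goldenRatio_irrational)
  have hx := Set.ext_iff.1 h (x : ℤ)
  rw [Set.mem_symmDiff, mem_beattySeq_pos_iff hp, mem_beattySeq_pos_iff (sq_nonneg phi)] at hx
  rw [xor_def]
  refine Iff.trans ?_ hx.symm
  simp

theorem exists_wA_or_wB (x : ℕ) : ∃ n, wA n = x ∨ wB n = x := by
  rcases Nat.eq_zero_or_pos x with rfl | hx
  · exact ⟨0, Or.inl wA_zero⟩
  · rcases (pos_iff_xor_wA_wB x).1 hx with ⟨⟨n, -, h⟩, -⟩ | ⟨⟨n, -, h⟩, -⟩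
    exacts [⟨n, Or.inl h⟩, ⟨n, Or.inr h⟩]

theorem le_wA (n : ℕ) : n ≤ wA n := wA_strictMono.le_apply

theorem eq_zero_of_wA_eq_wB {m n : ℕ} (h : wA m = wB n) : m = 0 ∧ n = 0 := by
  have hB := wB_eq_wA_add n
  have hm := le_wA m
  have hn := le_wA n
  have key : m = 0 ∨ n = 0 := by
    by_contra! hne
    have hpos : 0 < wA m := by omega
    rcases (pos_iff_xor_wA_wB _).1 hpos with ⟨-, h'⟩ | ⟨-, h'⟩
    · exact h' ⟨n, by omega, h.symm⟩
    · exact h' ⟨m, by omega, rfl⟩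
  rcases key with rfl | rfl
  · rw [wA_zero] at h; omega
  · rw [wA_zero] at hB; omega

theorem TkMove.swap {k : ℕ} {p q : ℕ × ℕ} (h : TkMove k p q) : TkMove k p.swap q.swap := by
  rcases h with ⟨t, h1, h2, rfl⟩ | ⟨t, h1, h2, rfl⟩ | ⟨s, h1, h2, h3, h4, rfl⟩
  · exact Or.inr (Or.inl ⟨t, h1, h2, rfl⟩)
  · exact Or.inl ⟨t, h1, h2, rfl⟩
  · refine Or.inr (Or.inr ⟨s, h1, ?_, ?_, ?_, rfl⟩)
    · simpa [min_comm] using h2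
    · simpa [min_comm] using h3
    · simpa [min_comm, max_comm] using h4

theorem TkMove.sum_lt {k : ℕ} {p q : ℕ × ℕ} (h : TkMove k p q) :
    q.1 + q.2 < p.1 + p.2 := by
  rcases h with ⟨t, h1, h2, rfl⟩ | ⟨t, h1, h2, rfl⟩ | ⟨s, h1, h2, h3, h4, rfl⟩ <;>
    dsimp only <;> omega

theorem IsPPositions.eq {move : ℕ × ℕ → ℕ × ℕ → Prop}
    (hmove : ∀ p q, move p q → q.1 + q.2 < p.1 + p.2) {S T : Set (ℕ × ℕ)}
    (hS : IsPPositions move S) (hT : IsPPositions move T) : S = T := by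
  have key : ∀ N, ∀ p : ℕ × ℕ, p.1 + p.2 = N → (p ∈ S ↔ p ∈ T) := by
    intro N
    induction N using Nat.strong_induction_on with
    | _ N ih =>
      rintro p rfl
      constructor
      · intro hp
        by_contra hpT
        obtain ⟨q, hq, hm⟩ := hT.2 p hpT
        exact hS.1 p hp q ((ih _ (hmove _ _ hm) q rfl).2 hq) hm
      · intro hp
        by_contra hpS
        obtain ⟨q, hq, hm⟩ := hS.2 p hpS
        exact hT.1 p hp q ((ih _ (hmove _ _ hm) q rfl).1 hq) hm
  ext p
  exact key _ p rfl

/-- The Wythoff P-positions shifted by one, together with the origin. -/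
def shiftedWythoff : Set (ℕ × ℕ) :=
  ({((0 : ℕ), (0 : ℕ))} : Set (ℕ × ℕ)) ∪
    {p : ℕ × ℕ | ∃ n, p = (wA n + 1, wB n + 1)} ∪
    {p : ℕ × ℕ | ∃ n, p = (wB n + 1, wA n + 1)}

theorem mem_shiftedWythoff {a b : ℕ} :
    (a, b) ∈ shiftedWythoff ↔ (a = 0 ∧ b = 0) ∨ (∃ n, a = wA n + 1 ∧ b = wB n + 1) ∨
      ∃ n, a = wB n + 1 ∧ b = wA n + 1 := by
  simp [shiftedWythoff, or_assoc]

theorem swap_mem_shiftedWythoff {p : ℕ × ℕ} (h : p ∈ shiftedWythoff) :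
    p.swap ∈ shiftedWythoff := by
  obtain ⟨a, b⟩ := p
  rw [mem_shiftedWythoff] at h
  rw [Prod.swap_prod_mk, mem_shiftedWythoff]
  rcases h with ⟨ha, hb⟩ | ⟨n, ha, hb⟩ | ⟨n, ha, hb⟩
  · exact Or.inl ⟨hb, ha⟩
  · exact Or.inr (Or.inr ⟨n, hb, ha⟩)
  · exact Or.inr (Or.inl ⟨n, hb, ha⟩)

theorem wB_strictMono : StrictMono wB := by
  intro m n h
  have := wA_strictMono h
  rw [wB_eq_wA_add, wB_eq_wA_add]
  omega

theorem shiftedWythoff_snd_injective {a b b' : ℕ} (h : (a, b) ∈ shiftedWythoff)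
    (h' : (a, b') ∈ shiftedWythoff) : b = b' := by
  rw [mem_shiftedWythoff] at h h'
  rcases h with ⟨ha, hb⟩ | ⟨n, ha, hb⟩ | ⟨n, ha, hb⟩ <;>
    rcases h' with ⟨ha', hb'⟩ | ⟨m, ha', hb'⟩ | ⟨m, ha', hb'⟩ <;> try omega
  · obtain rfl : n = m := wA_strictMono.injective (by omega)
    omega
  · obtain ⟨rfl, rfl⟩ := eq_zero_of_wA_eq_wB (m := n) (n := m) (by omega)
    have := wB_eq_wA_add 0
    omega
  · obtain ⟨rfl, rfl⟩ := eq_zero_of_wA_eq_wB (m := m) (n := n) (by omega)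
    have := wB_eq_wA_add 0
    omega
  · obtain rfl : n = m := wB_strictMono.injective (by omega)
    omega

theorem shiftedWythoff_diagonal {a b s : ℕ} (hs : s < min a b) (h : (a, b) ∈ shiftedWythoff)
    (h' : (a - s, b - s) ∈ shiftedWythoff) : s = 0 := by
  rw [mem_shiftedWythoff] at h h'
  rcases h with ⟨ha, hb⟩ | ⟨n, ha, hb⟩ | ⟨n, ha, hb⟩ <;>
    rcases h' with ⟨ha', hb'⟩ | ⟨m, ha', hb'⟩ | ⟨m, ha', hb'⟩ <;> try omega
  all_goals
    have hn := wB_eq_wA_add n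
    have hm := wB_eq_wA_add m
    obtain rfl : n = m := by omega
    omega

theorem not_tkMove_shiftedWythoff {k : ℕ} {p q : ℕ × ℕ} (hp : p ∈ shiftedWythoff)
    (hq : q ∈ shiftedWythoff) : ¬ TkMove k p q := by
  obtain ⟨a, b⟩ := p
  rintro (⟨t, h1, h2, rfl⟩ | ⟨t, h1, h2, rfl⟩ | ⟨s, h1, h2, h3, -, rfl⟩)
  · have : a = a - t :=
      shiftedWythoff_snd_injective (swap_mem_shiftedWythoff hp) (swap_mem_shiftedWythoff hq)
    dsimp only at *
    omega
  · have := shiftedWythoff_snd_injective hp hq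
    dsimp only at *
    omega
  · have := shiftedWythoff_diagonal (by dsimp only at *; omega) hp hq
    omega

theorem exists_tkMove_shiftedWythoff_of_le {k a b : ℕ} (hab : a ≤ b)
    (h : (a, b) ∉ shiftedWythoff) : ∃ q ∈ shiftedWythoff, TkMove k (a, b) q := by
  rcases Nat.eq_zero_or_pos a with rfl | ha
  · have hb : b ≠ 0 := by
      rintro rfl
      exact h (mem_shiftedWythoff.2 (Or.inl ⟨rfl, rfl⟩))
    exact ⟨(0, 0), mem_shiftedWythoff.2 (Or.inl ⟨rfl, rfl⟩),
      Or.inr (Or.inl ⟨b, by omega, le_rfl, by simp⟩)⟩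
  obtain ⟨x, rfl⟩ := Nat.exists_eq_add_of_lt ha
  obtain ⟨y, rfl⟩ : ∃ y, b = y + 1 := ⟨b - 1, by omega⟩
  rw [Nat.zero_add] at *
  obtain ⟨n, rfl | rfl⟩ := exists_wA_or_wB x
  · have hB := wB_eq_wA_add n
    have hne : y ≠ wB n := by
      rintro rfl
      exact h (mem_shiftedWythoff.2 (Or.inr (Or.inl ⟨n, rfl, rfl⟩)))
    rcases lt_or_gt_of_ne hne with hlt | hgt
    · obtain ⟨d, hd⟩ := Nat.exists_eq_add_of_le (show wA n ≤ y by omega)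
      have hdn : d < n := by omega
      have hA := wA_strictMono hdn
      have hBd := wB_eq_wA_add d
      have hn := le_wA n
      have hdd := le_wA d
      refine ⟨(wA d + 1, wB d + 1), mem_shiftedWythoff.2 (Or.inr (Or.inl ⟨d, rfl, rfl⟩)),
        Or.inr (Or.inr ⟨wA n - wA d, by omega, by dsimp only; omega,
          by dsimp only; omega, ?_, ?_⟩)⟩
      · have e1 : wA n + 1 - (wA n - wA d) = wA d + 1 := by omega
        have e2 : y + 1 - (wA n - wA d) = wB d + 1 := by omega
        have r1 : (wB d + 1) / (wA d + 1) = 1 := Nat.div_eq_of_lt_le (by omega) (by omega)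
        have r2 : (y + 1) / (wA n + 1) = 1 := Nat.div_eq_of_lt_le (by omega) (by omega)
        dsimp only
        rw [e1, e2, max_eq_right (by omega), min_eq_left (by omega), max_eq_right hab,
          min_eq_left hab, r1, r2]
        simp
      · ext <;> dsimp only <;> omega
    · exact ⟨(wA n + 1, wB n + 1), mem_shiftedWythoff.2 (Or.inr (Or.inl ⟨n, rfl, rfl⟩)),
        Or.inr (Or.inl ⟨y - wB n, by omega, by dsimp only; omega,
          Prod.ext rfl (by dsimp only; omega)⟩)⟩
  · have hB := wB_eq_wA_add n
    have hne : y ≠ wA n := by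
      rintro rfl
      exact h (mem_shiftedWythoff.2 (Or.inr (Or.inr ⟨n, rfl, rfl⟩)))
    exact ⟨(wB n + 1, wA n + 1), mem_shiftedWythoff.2 (Or.inr (Or.inr ⟨n, rfl, rfl⟩)),
      Or.inr (Or.inl ⟨y - wA n, by omega, by dsimp only; omega,
        Prod.ext rfl (by dsimp only; omega)⟩)⟩

theorem isPPositions_shiftedWythoff (k : ℕ) : IsPPositions (TkMove k) shiftedWythoff := by
  refine ⟨fun p hp q hq => not_tkMove_shiftedWythoff hp hq, ?_⟩
  rintro ⟨a, b⟩ h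
  rcases le_total a b with hab | hab
  · exact exists_tkMove_shiftedWythoff_of_le hab h
  · obtain ⟨q, hq, hm⟩ := exists_tkMove_shiftedWythoff_of_le (k := k) hab
      fun h' => h (swap_mem_shiftedWythoff h')
    exact ⟨q.swap, swap_mem_shiftedWythoff hq, hm.swap⟩

theorem Tk_P_positions (k : ℕ) (S : Set (ℕ × ℕ)) :
    IsPPositions (TkMove k) S ↔
      S = ({((0 : ℕ), (0 : ℕ))} : Set (ℕ × ℕ)) ∪
          {p : ℕ × ℕ | ∃ n, p = (wA n + 1, wB n + 1)} ∪
          {p : ℕ × ℕ | ∃ n, p = (wB n + 1, wA n + 1)} := by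
  exact ⟨fun h => h.eq (fun _ _ hm => hm.sum_lt) (isPPositions_shiftedWythoff k),
    fun h => h ▸ isPPositions_shiftedWythoff k⟩
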